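/- arXiv:2511.09395 — 2 statements merged into one kernel-verified Lean document; each statement's English description precedes it below -/
import Mathlib

section
/- Let a = a₁ e₁ + u ∈ ℝ^{2n+1} with u ∈ V₀, and let L_a : ℝ^{2n+1} → ℝ^{2n+1} be the linear map L_a(x) = a ∗ x. Then the characteristic polynomial of L_a (in the variable X) equals (X − a₁)^{2n−1} · ((X − a₁)² + ‖u‖²), and consequently det(L_a) = a₁^{2n−1} ‖a‖². -/
noncomputable section

/-- Standard dot product on `ℝ^m`. -/
def dot {m : ℕ} (a b : Fin m → ℝ) : ℝ := ∑ i, a i * b i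

/-- The distinguished unit vector `e₁` of the Vidinli algebra (index `0`). -/
def e1 (n : ℕ) : Fin (2*n+1) → ℝ := fun i => if i.val = 0 then 1 else 0

/-- The standard symplectic form `ω` on `ℝ^{2n+1}` (vanishing on `e₁`):
`ω(a,b) = Σ_{k=1}^n (a_{2k} b_{2k+1} − a_{2k+1} b_{2k})` in the paper's 1-based indexing. -/
def omg (n : ℕ) (a b : Fin (2*n+1) → ℝ) : ℝ :=
  ∑ k : Fin n,
    (a ⟨2*k.val+1, by have := k.isLt; omega⟩ * b ⟨2*k.val+2, by have := k.isLt; omega⟩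
   - a ⟨2*k.val+2, by have := k.isLt; omega⟩ * b ⟨2*k.val+1, by have := k.isLt; omega⟩)

/-- The Vidinli multiplication on `ℝ^{2n+1}`. -/
def vprod (n : ℕ) (a b : Fin (2*n+1) → ℝ) : Fin (2*n+1) → ℝ :=
  dot a (e1 n) • b + dot b (e1 n) • a - dot a b • e1 n + omg n a b • e1 n

lemma dot_add_right {m : ℕ} (a b c : Fin m → ℝ) :
    dot a (b + c) = dot a b + dot a c := by
  simp [dot, mul_add, Finset.sum_add_distrib]

lemma dot_smul_right {m : ℕ} (c : ℝ) (a b : Fin m → ℝ) :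
    dot a (c • b) = c * dot a b := by
  simp only [dot, Pi.smul_apply, smul_eq_mul, Finset.mul_sum]
  exact Finset.sum_congr rfl fun i _ => by ring

lemma dot_add_left {m : ℕ} (a b c : Fin m → ℝ) :
    dot (a + b) c = dot a c + dot b c := by
  simp [dot, add_mul, Finset.sum_add_distrib]

lemma dot_smul_left {m : ℕ} (c : ℝ) (a b : Fin m → ℝ) :
    dot (c • a) b = c * dot a b := by
  simp only [dot, Pi.smul_apply, smul_eq_mul, Finset.mul_sum]
  exact Finset.sum_congr rfl fun i _ => by ring

lemma omg_add_right (n : ℕ) (a b c : Fin (2*n+1) → ℝ) :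
    omg n a (b + c) = omg n a b + omg n a c := by
  simp only [omg, Pi.add_apply]
  rw [← Finset.sum_add_distrib]
  exact Finset.sum_congr rfl fun k _ => by ring

lemma omg_smul_right (n : ℕ) (c : ℝ) (a b : Fin (2*n+1) → ℝ) :
    omg n a (c • b) = c * omg n a b := by
  simp only [omg, Pi.smul_apply, smul_eq_mul, Finset.mul_sum]
  exact Finset.sum_congr rfl fun k _ => by ring

lemma omg_add_left (n : ℕ) (a b c : Fin (2*n+1) → ℝ) :
    omg n (a + b) c = omg n a c + omg n b c := by
  simp only [omg, Pi.add_apply]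
  rw [← Finset.sum_add_distrib]
  exact Finset.sum_congr rfl fun k _ => by ring

lemma omg_smul_left (n : ℕ) (c : ℝ) (a b : Fin (2*n+1) → ℝ) :
    omg n (c • a) b = c * omg n a b := by
  simp only [omg, Pi.smul_apply, smul_eq_mul, Finset.mul_sum]
  exact Finset.sum_congr rfl fun k _ => by ring

/-- Left multiplication `L_a(x) = a ∗ x` as a linear map. -/
def Lmul (n : ℕ) (a : Fin (2*n+1) → ℝ) :
    (Fin (2*n+1) → ℝ) →ₗ[ℝ] (Fin (2*n+1) → ℝ) where
  toFun x := vprod n a x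
  map_add' x y := by
    simp only [vprod, dot_add_right, omg_add_right, dot_add_left]
    module
  map_smul' c x := by
    simp only [vprod, dot_smul_right, omg_smul_right, dot_smul_left, RingHom.id_apply]
    module

/-- Right multiplication `R_a(x) = x ∗ a` as a linear map. -/
def Rmul (n : ℕ) (a : Fin (2*n+1) → ℝ) :
    (Fin (2*n+1) → ℝ) →ₗ[ℝ] (Fin (2*n+1) → ℝ) where
  toFun x := vprod n x a
  map_add' x y := by
    simp only [vprod, dot_add_left, omg_add_left, dot_add_right]
    module
  map_smul' c x := by
    simp only [vprod, dot_smul_left, omg_smul_left, dot_smul_right, RingHom.id_apply]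
    module

lemma omg_self (n : ℕ) (a : Fin (2*n+1) → ℝ) : omg n a a = 0 :=
  Finset.sum_eq_zero fun k _ => by ring

lemma omg_e1_right (n : ℕ) (a : Fin (2*n+1) → ℝ) : omg n a (e1 n) = 0 := by
  simp [omg, e1]

lemma omg_e1_left (n : ℕ) (a : Fin (2*n+1) → ℝ) : omg n (e1 n) a = 0 := by
  simp [omg, e1]

lemma dot_comm {m : ℕ} (a b : Fin m → ℝ) : dot a b = dot b a :=
  Finset.sum_congr rfl fun _ _ => mul_comm _ _

lemma dot_e1_e1 (n : ℕ) : dot (e1 n) (e1 n) = 1 := by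
  simp [dot, e1]

open Polynomial Module in
/-- The characteristic polynomials of `g ∘ f` and `f ∘ g` differ by a power of `X`. -/
lemma charpoly_comp_of_finrank_le {R M N : Type*} [CommRing R] [Nontrivial R]
    [AddCommGroup M] [Module R M] [Module.Free R M] [Module.Finite R M]
    [AddCommGroup N] [Module R N] [Module.Free R N] [Module.Finite R N]
    (f : M →ₗ[R] N) (g : N →ₗ[R] M) (h : finrank R N ≤ finrank R M) :
    (g ∘ₗ f).charpoly = X ^ (finrank R M - finrank R N) * (f ∘ₗ g).charpoly := by
  classical
  let b := Free.chooseBasis R M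
  let c := Free.chooseBasis R N
  rw [finrank_eq_card_basis b, finrank_eq_card_basis c] at h ⊢
  rw [← LinearMap.charpoly_toMatrix _ b, ← LinearMap.charpoly_toMatrix _ c,
    LinearMap.toMatrix_comp b c b, LinearMap.toMatrix_comp c b c,
    Matrix.charpoly_mul_comm_of_le _ _ h]

/-- The linear functional `x ↦ ω(u, x) − u · x`. -/
def omgSubDot (n : ℕ) (u : Fin (2*n+1) → ℝ) : (Fin (2*n+1) → ℝ) →ₗ[ℝ] ℝ where
  toFun x := omg n u x - dot u x
  map_add' x y := by
    simp only [omg_add_right, dot_add_right]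
    ring
  map_smul' c x := by
    simp only [omg_smul_right, dot_smul_right, RingHom.id_apply, smul_eq_mul]
    ring

/-- The map `x ↦ (x · e₁, ω(u, x) − u · x)`. -/
def coordPair (n : ℕ) (u : Fin (2*n+1) → ℝ) : (Fin (2*n+1) → ℝ) →ₗ[ℝ] (Fin 2 → ℝ) :=
  LinearMap.pi ![LinearMap.proj 0, omgSubDot n u]

lemma dot_e1_right (n : ℕ) (x : Fin (2*n+1) → ℝ) : dot x (e1 n) = x 0 := by
  simp [dot, e1]

lemma Lmul_sub_smul_id (n : ℕ) (a₁ : ℝ) (u : Fin (2*n+1) → ℝ) (hu : dot u (e1 n) = 0) :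
    Lmul n (a₁ • e1 n + u) - a₁ • 1
      = Fintype.linearCombination ℝ ![u, e1 n] ∘ₗ coordPair n u := by
  have hu0 : u 0 = 0 := by rw [← dot_e1_right n u, hu]
  have he : e1 n 0 = 1 := by simp [e1]
  refine LinearMap.ext fun x => ?_
  simp only [Lmul, vprod, coordPair, omgSubDot, LinearMap.sub_apply, LinearMap.coe_mk,
    AddHom.coe_mk, LinearMap.smul_apply, Module.End.one_apply, LinearMap.comp_apply,
    Fintype.linearCombination_apply, Fin.sum_univ_two, LinearMap.pi_apply,
    Matrix.cons_val_zero, Matrix.cons_val_one, LinearMap.proj_apply,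
    dot_add_left, dot_smul_left, omg_add_left, omg_smul_left, omg_e1_left,
    dot_comm (e1 n) x, dot_e1_right, Pi.add_apply, Pi.smul_apply, smul_eq_mul, hu0, he]
  module

open Polynomial in
lemma charpoly_coordPair_comp (n : ℕ) (u : Fin (2*n+1) → ℝ) (hu : dot u (e1 n) = 0) :
    (coordPair n u ∘ₗ Fintype.linearCombination ℝ ![u, e1 n]).charpoly
      = X ^ 2 + C (dot u u) := by
  have hu0 : u 0 = 0 := by rw [← dot_e1_right n u, hu]
  have he : e1 n 0 = 1 := by simp [e1]
  have hM : LinearMap.toMatrix' (coordPair n u ∘ₗ Fintype.linearCombination ℝ ![u, e1 n])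
      = !![0, 1; -dot u u, 0] := by
    ext i j
    fin_cases i <;> fin_cases j <;>
      simp [LinearMap.toMatrix'_apply, coordPair, omgSubDot, omg_self, omg_e1_right, hu, hu0, he]
  rw [← LinearMap.charpoly_toMatrix _ (Pi.basisFun ℝ (Fin 2)),
    LinearMap.toMatrix_eq_toMatrix', hM, Matrix.charpoly_fin_two]
  simp [Matrix.trace_fin_two, Matrix.det_fin_two]

open Polynomial in
/-- For `a = a₁e₁ + u` with `u ∈ V₀`, the characteristic polynomial
of left multiplication `L_a` is `(X − a₁)^{2n−1}((X − a₁)² + ‖u‖²)`, and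
`det L_a = a₁^{2n−1}‖a‖²`. -/
theorem vidinli_charpoly_Lmul (n : ℕ) (hn : 1 ≤ n) (a₁ : ℝ)
    (u a : Fin (2*n+1) → ℝ) (hu : dot u (e1 n) = 0) (ha : a = a₁ • e1 n + u) :
    (Lmul n a).charpoly
      = (X - C a₁) ^ (2*n - 1) * ((X - C a₁) ^ 2 + C (dot u u)) ∧
    LinearMap.det (Lmul n a) = a₁ ^ (2*n - 1) * dot a a := by
  have hchar : (Lmul n a).charpoly
      = (X - C a₁) ^ (2*n - 1) * ((X - C a₁) ^ 2 + C (dot u u)) := by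
    have hshift := LinearMap.charpoly_sub_smul (Lmul n a) a₁
    rw [ha, Lmul_sub_smul_id n a₁ u hu, charpoly_comp_of_finrank_le _ _ (by simp; omega),
      charpoly_coordPair_comp n u hu, ← ha] at hshift
    have hcomp := congrArg (fun p : ℝ[X] => p.comp (X - C a₁)) hshift
    simp only [comp_assoc] at hcomp
    simpa using hcomp.symm
  refine ⟨hchar, ?_⟩
  have hdot : dot a a = a₁ ^ 2 + dot u u := by
    simp only [ha, dot_add_left, dot_add_right, dot_smul_left, dot_smul_right, dot_e1_e1, hu,
      dot_comm (e1 n) u]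
    ring
  have hodd : Odd (2*n - 1) := ⟨n - 1, by omega⟩
  rw [LinearMap.det_eq_sign_charpoly_coeff, hchar, coeff_zero_eq_eval_zero, hdot]
  simp [hodd.neg_pow, pow_succ, pow_mul]
end
end

section
/- The multiplication algebra of the Vidinli algebra V_{2n+1} is the full endomorphism algebra: the unital ℝ-subalgebra of End_ℝ(ℝ^{2n+1}) generated by all left multiplication maps L_a(x) = a ∗ x and all right multiplication maps R_a(x) = x ∗ a, for a ∈ ℝ^{2n+1}, equals End_ℝ(ℝ^{2n+1}) (i.e. it is isomorphic to the matrix algebra M_{2n+1}(ℝ)). -/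
noncomputable section

/-- The matrix unit sending the `j`-th standard basis vector to the `i`-th one. -/
def matUnit {ι : Type*} [DecidableEq ι] (i j : ι) : Module.End ℝ (ι → ℝ) :=
  (LinearMap.proj j : (ι → ℝ) →ₗ[ℝ] ℝ).smulRight (Pi.single i 1)

lemma matUnit_apply {ι : Type*} [DecidableEq ι] (i j : ι) (x : ι → ℝ) :
    matUnit i j x = x j • Pi.single i (1 : ℝ) := rfl

lemma matUnit_mul_matUnit {ι : Type*} [DecidableEq ι] (i j k : ι) :
    matUnit i j * matUnit j k = matUnit i k := by
  refine LinearMap.ext fun x => ?_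
  simp [matUnit_apply, Module.End.mul_apply]

/-- A subalgebra of endomorphisms containing all matrix units is everything. -/
lemma subalgebra_eq_top_of_matUnit_mem {ι : Type*} [DecidableEq ι] [Fintype ι]
    (A : Subalgebra ℝ (Module.End ℝ (ι → ℝ))) (h : ∀ i j, matUnit i j ∈ A) : A = ⊤ := by
  rw [eq_top_iff]
  intro f _
  have hf : f = ∑ j, ∑ i, f (Pi.single j 1) i • matUnit i j := by
    refine LinearMap.pi_ext' fun k => LinearMap.ext_ring ?_
    ext l
    simp only [LinearMap.comp_apply, LinearMap.single_apply, LinearMap.sum_apply,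
      LinearMap.smul_apply, matUnit_apply, Finset.sum_apply, Pi.smul_apply]
    simp [Pi.single_apply]
  rw [hf]
  exact A.sum_mem fun j _ => A.sum_mem fun i _ => A.smul_mem (h i j) _

lemma e1_eq_single (n : ℕ) : e1 n = Pi.single 0 1 := by
  ext i
  simp only [e1, Pi.single_apply, Fin.ext_iff, Fin.val_zero]

lemma dot_single_left {m : ℕ} (i : Fin m) (c : ℝ) (x : Fin m → ℝ) :
    dot (Pi.single i c) x = c * x i := by
  simp [dot, Pi.single_apply]

lemma dot_single_right {m : ℕ} (i : Fin m) (c : ℝ) (x : Fin m → ℝ) :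
    dot x (Pi.single i c) = x i * c := by
  simp [dot, Pi.single_apply]

lemma omg_swap (n : ℕ) (a b : Fin (2*n+1) → ℝ) : omg n a b = - omg n b a := by
  simp only [omg, ← Finset.sum_neg_distrib]
  exact Finset.sum_congr rfl fun k _ => by ring

lemma Lmul_sub_Rmul_apply (n : ℕ) (a x : Fin (2*n+1) → ℝ) :
    (Lmul n a - Rmul n a) x = (2 * omg n a x) • e1 n := by
  change vprod n a x - vprod n x a = _
  rw [vprod, vprod, omg_swap n x a, dot_comm x a]
  module

lemma Lmul_add_Rmul_apply (n : ℕ) (a x : Fin (2*n+1) → ℝ) :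
    (Lmul n a + Rmul n a) x =
      (2 * a 0) • x + (2 * x 0) • a - (2 * dot a x) • e1 n := by
  change vprod n a x + vprod n x a = _
  rw [vprod, vprod, omg_swap n x a, dot_comm x a, e1_eq_single, dot_single_right,
    dot_single_right]
  module

/-- Every coordinate functional other than the zeroth is represented by `ω`. -/
lemma exists_omg_eq_apply (n : ℕ) (j : Fin (2*n+1)) (hj : j ≠ 0) :
    ∃ a : Fin (2*n+1) → ℝ, ∀ x, omg n a x = x j := by
  obtain ⟨j, hjn⟩ := j
  have hj0 : j ≠ 0 := fun h => hj (Fin.ext h)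
  obtain ⟨k, rfl | rfl⟩ : ∃ k, j = 2 * k + 1 ∨ j = 2 * k + 2 := ⟨(j - 1) / 2, by omega⟩
  · refine ⟨Pi.single ⟨2 * k + 2, by omega⟩ (-1), fun x => ?_⟩
    rw [omg, Finset.sum_eq_single ⟨k, by omega⟩]
    · simp
    · intro b _ hb
      have hbk : b.val ≠ k := fun h => hb (Fin.ext h)
      have : 2 * b.val ≠ 2 * k + 1 := by omega
      simp [hbk, this]
    · simp
  · refine ⟨Pi.single ⟨2 * k + 1, by omega⟩ 1, fun x => ?_⟩
    rw [omg, Finset.sum_eq_single ⟨k, by omega⟩]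
    · simp
    · intro b _ hb
      have hbk : b.val ≠ k := fun h => hb (Fin.ext h)
      have : 2 * b.val + 1 ≠ 2 * k := by omega
      simp [hbk, this]
    · simp

/-- The multiplication algebra of `V_{2n+1}` — the unital
`ℝ`-subalgebra of `End_ℝ(ℝ^{2n+1})` generated by all left and right
multiplication operators — is the full endomorphism algebra. -/
theorem vidinli_multiplication_algebra_full (n : ℕ) (hn : 1 ≤ n) :
    Algebra.adjoin ℝ
      {f : Module.End ℝ (Fin (2*n+1) → ℝ) |
        (∃ a : Fin (2*n+1) → ℝ, f = Lmul n a) ∨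
        (∃ a : Fin (2*n+1) → ℝ, f = Rmul n a)} = ⊤ := by
  set A := Algebra.adjoin ℝ
      {f : Module.End ℝ (Fin (2*n+1) → ℝ) |
        (∃ a : Fin (2*n+1) → ℝ, f = Lmul n a) ∨
        (∃ a : Fin (2*n+1) → ℝ, f = Rmul n a)}
  have hL (a) : Lmul n a ∈ A := Algebra.subset_adjoin (Or.inl ⟨a, rfl⟩)
  have hR (a) : Rmul n a ∈ A := Algebra.subset_adjoin (Or.inr ⟨a, rfl⟩)
  have hrow (j : Fin (2*n+1)) (hj : j ≠ 0) : matUnit 0 j ∈ A := by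
    obtain ⟨a, ha⟩ := exists_omg_eq_apply n j hj
    have h : matUnit 0 j = (2⁻¹ : ℝ) • (Lmul n a - Rmul n a) := by
      refine LinearMap.ext fun x => ?_
      rw [LinearMap.smul_apply, Lmul_sub_Rmul_apply, ha, matUnit_apply, e1_eq_single]
      module
    exact h ▸ A.smul_mem (A.sub_mem (hL a) (hR a)) _
  have hcol (i : Fin (2*n+1)) (hi : i ≠ 0) : matUnit i 0 ∈ A := by
    have h : matUnit i 0 =
        (2⁻¹ : ℝ) • (Lmul n (Pi.single i 1) + Rmul n (Pi.single i 1)) + matUnit 0 i := by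
      refine LinearMap.ext fun x => ?_
      rw [LinearMap.add_apply, LinearMap.smul_apply, Lmul_add_Rmul_apply, matUnit_apply,
        matUnit_apply, e1_eq_single, dot_single_left, Pi.single_eq_of_ne hi.symm]
      module
    exact h ▸ A.add_mem (A.smul_mem (A.add_mem (hL _) (hR _)) _) (hrow i hi)
  have hcorner : matUnit 0 0 ∈ A := by
    have h1 : (⟨1, by omega⟩ : Fin (2*n+1)) ≠ 0 := by simp [Fin.ext_iff]
    rw [← matUnit_mul_matUnit 0 ⟨1, by omega⟩ 0]
    exact A.mul_mem (hrow _ h1) (hcol _ h1)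
  refine subalgebra_eq_top_of_matUnit_mem A fun i j => ?_
  rw [← matUnit_mul_matUnit i 0 j]
  refine A.mul_mem ?_ ?_
  · rcases eq_or_ne i 0 with rfl | hi
    exacts [hcorner, hcol i hi]
  · rcases eq_or_ne j 0 with rfl | hj
    exacts [hcorner, hrow j hj]
end
end
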